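/- Let H be a connected hypergraph satisfying Condition (LV) and K a field. Then L_K(H) is semiprimitive: the Jacobson radical of L_K(H) is the zero ideal. -/

import Mathlib

open scoped Classical

/-- The generators of the Leavitt path algebra of a hypergraph `H = (H0, H1, s, r)`:
a vertex generator `v` for every `v ∈ H0`, and generators `h_{ij}` (`edge`) and
`h_{ij}^*` (`ghost`) for every hyperedge `h ∈ H1`, `1 ≤ i ≤ |s(h)|`, `1 ≤ j ≤ |r(h)|`.
The multisets `s(h)` and `r(h)` are given as (enumerated) lists over `H0`. -/
inductive HGen (H0 H1 : Type) (s r : H1 → List H0) : Type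
  | vertex (v : H0) : HGen H0 H1 s r
  | edge (h : H1) (i : Fin (s h).length) (j : Fin (r h).length) : HGen H0 H1 s r
  | ghost (h : H1) (i : Fin (s h).length) (j : Fin (r h).length) : HGen H0 H1 s r

namespace HLPA

variable (K : Type) [Field K] (H0 H1 : Type) (s r : H1 → List H0)

/-- The defining relations (i)-(iv) of the Leavitt path algebra of a hypergraph,
imposed on the free algebra on the generators. -/
inductive Rel : FreeAlgebra K (HGen H0 H1 s r) → FreeAlgebra K (HGen H0 H1 s r) → Prop
  | vtx (u v : H0) :
      Rel (FreeAlgebra.ι K (HGen.vertex u : HGen H0 H1 s r) * FreeAlgebra.ι K (HGen.vertex v))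
        (if u = v then FreeAlgebra.ι K (HGen.vertex u : HGen H0 H1 s r) else 0)
  | src_edge (h : H1) (i : Fin (s h).length) (j : Fin (r h).length) :
      Rel (FreeAlgebra.ι K (HGen.vertex ((s h).get i) : HGen H0 H1 s r) *
            FreeAlgebra.ι K (HGen.edge h i j))
        (FreeAlgebra.ι K (HGen.edge h i j))
  | edge_rng (h : H1) (i : Fin (s h).length) (j : Fin (r h).length) :
      Rel (FreeAlgebra.ι K (HGen.edge h i j : HGen H0 H1 s r) *
            FreeAlgebra.ι K (HGen.vertex ((r h).get j)))
        (FreeAlgebra.ι K (HGen.edge h i j))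
  | rng_ghost (h : H1) (i : Fin (s h).length) (j : Fin (r h).length) :
      Rel (FreeAlgebra.ι K (HGen.vertex ((r h).get j) : HGen H0 H1 s r) *
            FreeAlgebra.ι K (HGen.ghost h i j))
        (FreeAlgebra.ι K (HGen.ghost h i j))
  | ghost_src (h : H1) (i : Fin (s h).length) (j : Fin (r h).length) :
      Rel (FreeAlgebra.ι K (HGen.ghost h i j : HGen H0 H1 s r) *
            FreeAlgebra.ι K (HGen.vertex ((s h).get i)))
        (FreeAlgebra.ι K (HGen.ghost h i j))
  | cuntz1 (h : H1) (i i' : Fin (s h).length) :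
      Rel (∑ k : Fin (r h).length,
            FreeAlgebra.ι K (HGen.edge h i k : HGen H0 H1 s r) *
              FreeAlgebra.ι K (HGen.ghost h i' k))
        (if i = i' then FreeAlgebra.ι K (HGen.vertex ((s h).get i) : HGen H0 H1 s r) else 0)
  | cuntz2 (h : H1) (j j' : Fin (r h).length) :
      Rel (∑ k : Fin (s h).length,
            FreeAlgebra.ι K (HGen.ghost h k j : HGen H0 H1 s r) *
              FreeAlgebra.ι K (HGen.edge h k j'))
        (if j = j' then FreeAlgebra.ι K (HGen.vertex ((r h).get j) : HGen H0 H1 s r) else 0)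

/-- The universal unital algebra on the generators subject to the relations (i)-(iv);
it is the unitalization of the Leavitt path algebra of the hypergraph. -/
abbrev Ambient : Type := RingQuot (Rel K H0 H1 s r)

/-- The image of a generator in the ambient algebra. -/
noncomputable def amb (g : HGen H0 H1 s r) : Ambient K H0 H1 s r :=
  RingQuot.mkAlgHom K (Rel K H0 H1 s r) (FreeAlgebra.ι K g)

/-- The Leavitt path algebra of the hypergraph `(H0, H1, s, r)`, realized as the
non-unital subalgebra generated by the generators inside the universal unital algebra
on the generators subject to the relations (i)-(iv). (This is the algebra presented,
in the category of not necessarily unital `K`-algebras, by said generators and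
relations.) -/
noncomputable def LPAsub : NonUnitalSubalgebra K (Ambient K H0 H1 s r) :=
  NonUnitalAlgebra.adjoin K (Set.range (amb K H0 H1 s r))

/-- The Leavitt path algebra `L_K(H)` of the hypergraph `H = (H0, H1, s, r)`. -/
abbrev LPA : Type := ↥(LPAsub K H0 H1 s r)

variable {H0 H1 s r}

/-- A generator, as an element of the Leavitt path algebra. -/
noncomputable def genL (g : HGen H0 H1 s r) : LPA K H0 H1 s r :=
  ⟨amb K H0 H1 s r g, NonUnitalAlgebra.subset_adjoin K (Set.mem_range_self g)⟩

/-- The vertex generator `v ∈ H0` as an element of the Leavitt path algebra. -/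
noncomputable def vgen (v : H0) : LPA K H0 H1 s r := genL K (HGen.vertex v)

/-- The generator `h_{ij}` as an element of the Leavitt path algebra. -/
noncomputable def egen (h : H1) (i : Fin (s h).length) (j : Fin (r h).length) :
    LPA K H0 H1 s r := genL K (HGen.edge h i j)

/-- The generator `h_{ij}^*` as an element of the Leavitt path algebra. -/
noncomputable def ggen (h : H1) (i : Fin (s h).length) (j : Fin (r h).length) :
    LPA K H0 H1 s r := genL K (HGen.ghost h i j)

end HLPA

namespace HLPA

variable (K : Type) [Field K] (H0 H1 : Type) (s r : H1 → List H0)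

noncomputable instance instLPANonUnitalRing : NonUnitalRing (LPA K H0 H1 s r) :=
  NonUnitalSubalgebra.toNonUnitalRing (LPAsub K H0 H1 s r)

noncomputable instance instLPAAddCommGroup : AddCommGroup (LPA K H0 H1 s r) :=
  (instLPANonUnitalRing K H0 H1 s r).toAddCommGroup

noncomputable instance instLPAModule : Module K (LPA K H0 H1 s r) :=
  (LPAsub K H0 H1 s r).instModule

end HLPA

namespace HLPA

variable {H0 H1 : Type} {s r : H1 → List H0}

/-- The source vertex of a letter (edge, ghost edge or vertex) in the double graph of
the directed graph associated to the hypergraph. -/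
def letterSrc : HGen H0 H1 s r → H0
  | .vertex v => v
  | .edge h i _ => (s h).get i
  | .ghost h _ j => (r h).get j

/-- The range vertex of a letter in the double graph of the directed graph associated
to the hypergraph. -/
def letterRng : HGen H0 H1 s r → H0
  | .vertex v => v
  | .edge h _ j => (r h).get j
  | .ghost h i _ => (s h).get i

/-- Whether a letter is a vertex letter. -/
def IsVertexLetter : HGen H0 H1 s r → Prop
  | .vertex _ => True
  | _ => False

/-- A d-path: a path in the double graph of the directed graph associated to the
hypergraph, i.e. either a single vertex (length `0`), or a nonempty word of edges and
ghost edges in which the range of each letter is the source of the next one. -/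
def IsDPath (l : List (HGen H0 H1 s r)) : Prop :=
  (∃ v : H0, l = [HGen.vertex v]) ∨
    (l ≠ [] ∧ (∀ x ∈ l, ¬ IsVertexLetter x) ∧
      l.Chain' fun x y => letterRng x = letterSrc y)

/-- The forbidden two-letter words `h_{i1} h_{j1}^*` and `h_{1i}^* h_{1j}`
(indices here are `0`-based, so `1` becomes `0`). -/
def Forbidden : HGen H0 H1 s r → HGen H0 H1 s r → Prop
  | .edge h _ j, .ghost h' _ j' => h = h' ∧ (j : ℕ) = 0 ∧ (j' : ℕ) = 0
  | .ghost h i _, .edge h' i' _ => h = h' ∧ (i : ℕ) = 0 ∧ (i' : ℕ) = 0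
  | _, _ => False

/-- A nod-path (normal d-path): a d-path none of whose subwords is forbidden. -/
def IsNodPath (l : List (HGen H0 H1 s r)) : Prop :=
  IsDPath l ∧ l.Chain' fun x y => ¬ Forbidden x y

/-- The length of a d-path: `0` for a single vertex, and the word length otherwise. -/
def nodLength : List (HGen H0 H1 s r) → ℕ
  | [HGen.vertex _] => 0
  | l => l.length

variable (K : Type) [Field K]

/-- The image of a word over the generators in the Leavitt path algebra
(the product of its letters; junk value `0` for the empty word). -/
noncomputable def wordProd : List (HGen H0 H1 s r) → LPA K H0 H1 s r
  | [] => 0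
  | [g] => genL K g
  | g :: g' :: t => genL K g * wordProd (g' :: t)

end HLPA

/-- `I` is a two-sided ideal of the (not necessarily unital) ring `R`, encoded as a set. -/
def IsTwoSidedIdealSet (R : Type) [NonUnitalRing R] (I : Set R) : Prop :=
  0 ∈ I ∧ (∀ x ∈ I, ∀ y ∈ I, x + y ∈ I) ∧ (∀ x ∈ I, -x ∈ I) ∧
    (∀ (a : R), ∀ x ∈ I, a * x ∈ I) ∧ (∀ (a : R), ∀ x ∈ I, x * a ∈ I)

/-- An element `x` of a ring is left quasi-regular if there is `y` with `x + y = y * x`. -/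
def IsLeftQuasiRegular {R : Type} [NonUnitalRing R] (x : R) : Prop :=
  ∃ y : R, x + y = y * x

/-- `R` is semiprimitive: its Jacobson radical is zero, i.e. every two-sided ideal
consisting of left quasi-regular elements is the zero ideal. -/
def Semiprimitive (R : Type) [NonUnitalRing R] : Prop :=
  ∀ J : Set R, IsTwoSidedIdealSet R J → (∀ x ∈ J, IsLeftQuasiRegular x) → J = {0}

/-- A hypergraph together with the opposite `bar t` of every hyperedge `t`: the letters
`⟨t, i, k⟩` and `⟨bar t, k, j⟩` are the entries of two mutually inverse matrices, and
`vert t i` is the `i`-th source vertex of `t`. -/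
structure DoubledHypergraph (V T : Type) where
  sz : T → ℕ
  vert : T → ℕ → V
  bar : T → T
  bar_bar : ∀ t, bar (bar t) = t
  two_le_sz : ∀ t, 2 ≤ sz t

/-- A matrix entry attached to an oriented hyperedge. -/
@[ext] structure Letter (T : Type) where
  edge : T
  row : ℕ
  col : ℕ

namespace DoubledHypergraph

variable {V T : Type} (D : DoubledHypergraph V T)

attribute [simp] bar_bar

def src (x : Letter T) : V := D.vert x.edge x.row

def rng (x : Letter T) : V := D.vert (D.bar x.edge) x.col

def Valid (x : Letter T) : Prop := x.row < D.sz x.edge ∧ x.col < D.sz (D.bar x.edge)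

/-- The two-letter words `⟨t, i, 0⟩ ⟨bar t, 0, j⟩`, which are rewritten. -/
def Forb (x y : Letter T) : Prop := y.edge = D.bar x.edge ∧ x.col = 0 ∧ y.row = 0

/-- The first vertex of a word ending at `e`. -/
def start (e : V) : List (Letter T) → V
  | [] => e
  | x :: _ => D.src x

/-- The word is a path ending at `e` without forbidden subwords. -/
def Normal (e : V) : List (Letter T) → Prop
  | [] => True
  | x :: l => D.Valid x ∧ D.rng x = D.start e l ∧ (∀ y ∈ l.head?, ¬ D.Forb x y) ∧ Normal e l

variable {D} {e : V}

theorem Normal.tail {x : Letter T} {l : List (Letter T)} (h : D.Normal e (x :: l)) :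
    D.Normal e l := h.2.2.2

theorem Normal.change_row {t : T} {i i' c : ℕ} {l : List (Letter T)}
    (h : D.Normal e (⟨t, i, c⟩ :: l)) (hi : i' < D.sz t) : D.Normal e (⟨t, i', c⟩ :: l) :=
  ⟨⟨hi, h.1.2⟩, h.2.1, h.2.2.1, h.2.2.2⟩

theorem Normal.cons_cons {t : T} {i j k k' : ℕ} {l : List (Letter T)}
    (h : D.Normal e (⟨D.bar t, k', j⟩ :: l)) (hi : i < D.sz t) (hk : k < D.sz (D.bar t))
    (hk0 : k ≠ 0) : D.Normal e (⟨t, i, k⟩ :: ⟨D.bar t, k, j⟩ :: l) :=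
  ⟨⟨hi, hk⟩, rfl, by simp [Forb, hk0], h.change_row hk⟩

theorem Normal.append {v w : V} {q : List (Letter T)} (hq : D.Normal w q)
    (hv : D.start w q = v) : ∀ {p : List (Letter T)}, D.Normal v p →
    (∀ x ∈ p.getLast?, ∀ y ∈ q.head?, ¬ D.Forb x y) → D.Normal w (p ++ q)
  | [], _, _ => hq
  | [x], hp, hj => ⟨hp.1, hp.2.1.trans hv.symm, by simpa using hj, hq⟩
  | x :: y :: p, hp, hj => by
    refine ⟨hp.1, hp.2.1, ?_, Normal.append hq hv hp.tail ?_⟩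
    · simpa using hp.2.2.1
    · simpa using hj

variable (K : Type) [Field K] (D) (e)

/-- The normal form of the product of a letter and a composable normal word. -/
noncomputable def letterWord (x : Letter T) : List (Letter T) → (List (Letter T) →₀ K)
  | [] => Finsupp.single [x] 1
  | y :: l =>
    if D.Forb x y then
      (if x.row = y.col then Finsupp.single l 1 else 0) -
        ∑ k ∈ Finset.Ico 1 (D.sz (D.bar x.edge)),
          Finsupp.single (⟨x.edge, x.row, k⟩ :: ⟨y.edge, k, y.col⟩ :: l) 1
    else Finsupp.single (x :: y :: l) 1

/-- Left multiplication by a letter on the space of normal words ending at `e`, extended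
by zero to all words. -/
noncomputable def letterOp (x : Letter T) : Module.End K (List (Letter T) →₀ K) :=
  Finsupp.linearCombination K fun l =>
    if D.Normal e l ∧ D.Valid x ∧ D.rng x = D.start e l then D.letterWord K x l else 0

/-- Left multiplication by a vertex on the space of normal words ending at `e`, extended
by zero to all words. -/
noncomputable def vertexOp (u : V) : Module.End K (List (Letter T) →₀ K) :=
  Finsupp.linearCombination K fun l =>
    if D.Normal e l ∧ D.start e l = u then Finsupp.single l 1 else 0

variable {D e}

theorem letterOp_single (x : Letter T) (l : List (Letter T)) :
    D.letterOp e K x (Finsupp.single l 1) =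
      if D.Normal e l ∧ D.Valid x ∧ D.rng x = D.start e l then D.letterWord K x l else 0 := by
  simp [letterOp]

theorem vertexOp_single (u : V) (l : List (Letter T)) :
    D.vertexOp e K u (Finsupp.single l 1) =
      if D.Normal e l ∧ D.start e l = u then Finsupp.single l 1 else 0 := by
  simp [vertexOp]

theorem letterOp_cons {x : Letter T} {l : List (Letter T)} (h : D.Normal e (x :: l)) :
    D.letterOp e K x (Finsupp.single l 1) = Finsupp.single (x :: l) 1 := by
  obtain ⟨h1, h2, h3, h4⟩ := h
  rw [letterOp_single, if_pos ⟨h4, h1, h2⟩]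
  cases l with
  | nil => rfl
  | cons y l => exact if_neg (h3 y rfl)

theorem letterOp_forb {t : T} {i j : ℕ} {l : List (Letter T)} (hi : i < D.sz t)
    (h : D.Normal e (⟨D.bar t, 0, j⟩ :: l)) :
    D.letterOp e K ⟨t, i, 0⟩ (Finsupp.single (⟨D.bar t, 0, j⟩ :: l) 1) =
      (if i = j then Finsupp.single l 1 else 0) -
        ∑ k ∈ Finset.Ico 1 (D.sz (D.bar t)),
          Finsupp.single (⟨t, i, k⟩ :: ⟨D.bar t, k, j⟩ :: l) 1 := by
  rw [letterOp_single, if_pos ⟨h, ⟨hi, h.1.1⟩, rfl⟩]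
  exact if_pos ⟨rfl, rfl, rfl⟩

/-- The span of the normal words from `u` to `e`. -/
noncomputable def normalSpan (D : DoubledHypergraph V T) (e u : V) :
    Submodule K (List (Letter T) →₀ K) :=
  Finsupp.supported K K {l | D.Normal e l ∧ D.start e l = u}

theorem vertexOp_mem (u : V) (m : List (Letter T) →₀ K) :
    D.vertexOp e K u m ∈ D.normalSpan K e u := by
  induction m using Finsupp.induction_linear with
  | zero => simp
  | add f g hf hg => rw [map_add]; exact add_mem hf hg
  | single l c =>
    rw [← mul_one c, ← smul_eq_mul, ← Finsupp.smul_single, map_smul, vertexOp_single]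
    refine Submodule.smul_mem _ _ ?_
    split_ifs with h
    · exact Finsupp.single_mem_supported K _ h
    · exact zero_mem _

theorem vertexOp_eq_self {u : V} {m : List (Letter T) →₀ K} (h : m ∈ D.normalSpan K e u) :
    D.vertexOp e K u m = m := by
  rw [normalSpan, Finsupp.supported_eq_span_single] at h
  induction h using Submodule.span_induction with
  | mem x hx =>
    obtain ⟨l, hl, rfl⟩ := hx
    rw [vertexOp_single]
    exact if_pos hl
  | zero => simp
  | add x y _ _ hx hy => rw [map_add, hx, hy]
  | smul a x _ hx => rw [map_smul, hx]

theorem letterOp_single_mem (x : Letter T) (l : List (Letter T)) :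
    D.letterOp e K x (Finsupp.single l 1) ∈ D.normalSpan K e (D.src x) := by
  rw [letterOp_single]
  split_ifs with h
  swap
  · exact zero_mem _
  obtain ⟨hl, hx, hxl⟩ := h
  have hcons : ∀ l, D.Normal e (x :: l) →
      Finsupp.single (x :: l) (1 : K) ∈ D.normalSpan K e (D.src x) :=
    fun l h => Finsupp.single_mem_supported K _ ⟨h, rfl⟩
  cases l with
  | nil => exact hcons _ ⟨hx, hxl, by simp, hl⟩
  | cons y l =>
    rw [letterWord]
    split_ifs with hf hxy
    · obtain ⟨t, i, k⟩ := x
      obtain ⟨t', k', j⟩ := y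
      obtain ⟨rfl, rfl, rfl⟩ : t' = D.bar t ∧ k = 0 ∧ k' = 0 := hf
      obtain rfl : i = j := hxy
      refine sub_mem (Finsupp.single_mem_supported K _ ⟨hl.tail, ?_⟩) (sum_mem fun k hk => ?_)
      · rw [← hl.2.1]; simp [rng, src]
      · rw [Finset.mem_Ico] at hk
        exact Finsupp.single_mem_supported K _
          ⟨hl.cons_cons hx.1 hk.2 (by lia), rfl⟩
    · obtain ⟨t, i, k⟩ := x
      obtain ⟨t', k', j⟩ := y
      obtain ⟨rfl, rfl, rfl⟩ : t' = D.bar t ∧ k = 0 ∧ k' = 0 := hf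
      refine sub_mem (zero_mem _) (sum_mem fun k hk => ?_)
      rw [Finset.mem_Ico] at hk
      exact Finsupp.single_mem_supported K _
          ⟨hl.cons_cons hx.1 hk.2 (by lia), rfl⟩
    · exact hcons _ ⟨hx, hxl, by simpa using hf, hl⟩

theorem sum_letterOp_cons {t : T} {i j : ℕ} {l : List (Letter T)} (hi : i < D.sz t)
    (h : D.Normal e (⟨D.bar t, 0, j⟩ :: l)) :
    ∑ k ∈ Finset.range (D.sz (D.bar t)),
        D.letterOp e K ⟨t, i, k⟩ (Finsupp.single (⟨D.bar t, k, j⟩ :: l) 1) =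
      if i = j then Finsupp.single l 1 else 0 := by
  rw [Finset.range_eq_Ico, Finset.sum_eq_sum_Ico_succ_bot h.1.1, letterOp_forb K hi h,
    Finset.sum_congr rfl fun k hk => letterOp_cons K
      (h.cons_cons hi (Finset.mem_Ico.1 hk).2 (by have := (Finset.mem_Ico.1 hk).1; lia))]
  simp

theorem sum_letterOp_letterOp {t : T} {i j : ℕ} (hi : i < D.sz t) (hj : j < D.sz t)
    (l : List (Letter T)) :
    ∑ k ∈ Finset.range (D.sz (D.bar t)),
        D.letterOp e K ⟨t, i, k⟩ (D.letterOp e K ⟨D.bar t, k, j⟩ (Finsupp.single l 1)) =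
      if i = j then D.vertexOp e K (D.vert t i) (Finsupp.single l 1) else 0 := by
  have h0 : 0 < D.sz (D.bar t) := by have := D.two_le_sz (D.bar t); lia
  by_cases hl : D.Normal e l ∧ D.start e l = D.vert t j
  swap
  · rw [Finset.sum_eq_zero fun k _ => ?_]
    · split_ifs with hij
      · subst hij
        rw [vertexOp_single, if_neg hl]
      · rfl
    · rw [letterOp_single, if_neg, map_zero]
      rintro ⟨h1, -, h2⟩
      exact hl ⟨h1, by rw [← h2]; simp [rng]⟩
  rw [vertexOp_single]
  obtain ⟨hl, hs⟩ := hl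
  by_cases hf : ∀ y ∈ l.head?, ¬ D.Forb ⟨D.bar t, 0, j⟩ y
  · have hN : D.Normal e (⟨D.bar t, 0, j⟩ :: l) :=
      ⟨⟨h0, by simpa using hj⟩, by simp [rng, hs], hf, hl⟩
    rw [Finset.sum_congr rfl fun k hk => by
      rw [letterOp_cons K (hN.change_row (Finset.mem_range.1 hk))], sum_letterOp_cons K hi hN]
    split_ifs with h1 h2
    · rfl
    · exact absurd ⟨hl, h1 ▸ hs⟩ h2
    · rfl
  · push Not at hf
    obtain ⟨y, hy, hf⟩ := hf
    cases l with
    | nil => simp at hy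
    | cons y' l =>
    obtain rfl : y' = y := by simpa using hy
    obtain ⟨t', k', c⟩ := y'
    obtain ⟨ht, rfl, rfl⟩ : t' = D.bar (D.bar t) ∧ j = 0 ∧ k' = 0 := hf
    rw [D.bar_bar] at ht
    subst ht
    have hc : c < D.sz (D.bar t') := hl.1.2
    have key : ∀ k ∈ Finset.range (D.sz (D.bar t')), D.letterOp e K ⟨t', i, k⟩
        (D.letterOp e K ⟨D.bar t', k, 0⟩ (Finsupp.single (⟨t', 0, c⟩ :: l) 1)) =
        (if k = c then Finsupp.single (⟨t', i, c⟩ :: l) 1 else 0) -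
        ∑ m ∈ Finset.Ico 1 (D.sz t'),
          D.letterOp e K ⟨t', i, k⟩ (Finsupp.single (⟨D.bar t', k, m⟩ :: ⟨t', m, c⟩ :: l) 1) := by
      intro k hk
      have := letterOp_forb (D := D) (e := e) K (t := D.bar t') (i := k) (j := c) (l := l)
        (Finset.mem_range.1 hk) (by simpa using hl)
      simp only [bar_bar] at this
      rw [this, map_sub, map_sum]
      congr 1
      split_ifs with hkc
      · subst hkc
        exact letterOp_cons K (hl.change_row hi)
      · exact map_zero _
    rw [Finset.sum_congr rfl key, Finset.sum_sub_distrib, Finset.sum_comm,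
      Finset.sum_congr rfl fun m hm => sum_letterOp_cons K hi ?_]
    · rw [Finset.sum_ite_eq', Finset.sum_ite_eq, if_pos (Finset.mem_range.2 hc)]
      rcases Nat.eq_zero_or_pos i with rfl | hpos
      · simp [hl, start, src]
      · rw [if_pos (Finset.mem_Ico.2 ⟨hpos, hi⟩), if_neg hpos.ne', sub_self]
    · rw [Finset.mem_Ico] at hm
      refine ⟨⟨h0, by simpa using hm.2⟩, by simp [rng, start, src], ?_, hl.change_row hm.2⟩
      have : m ≠ 0 := by lia
      simp [Forb, this]

/-- Elements of a ring satisfying the relations of the Leavitt path algebra. -/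
structure CuntzFamily (D : DoubledHypergraph V T) (A : Type) [Ring A] where
  vtx : V → A
  ltr : Letter T → A
  vtx_mul_vtx : ∀ u v, vtx u * vtx v = if u = v then vtx u else 0
  src_mul : ∀ x, D.Valid x → vtx (D.src x) * ltr x = ltr x
  mul_rng : ∀ x, D.Valid x → ltr x * vtx (D.rng x) = ltr x
  sum_mul : ∀ t i j, i < D.sz t → j < D.sz t →
    ∑ k ∈ Finset.range (D.sz (D.bar t)), ltr ⟨t, i, k⟩ * ltr ⟨D.bar t, k, j⟩ =
      if i = j then vtx (D.vert t i) else 0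

variable (D e) in
/-- The left multiplication operators on normal words. -/
noncomputable def opFamily : CuntzFamily D (Module.End K (List (Letter T) →₀ K)) where
  vtx := D.vertexOp e K
  ltr := D.letterOp e K
  vtx_mul_vtx u v := by
    refine Finsupp.lhom_ext' fun l => LinearMap.ext_ring ?_
    by_cases h : D.Normal e l ∧ D.start e l = v
    · by_cases huv : u = v
      · subst huv
        simp [vertexOp_single, h]
      · simp [vertexOp_single, h, Ne.symm huv, huv]
    · by_cases huv : u = v
      · subst huv
        simp [vertexOp_single, h]
      · simp [vertexOp_single, h, huv]
  src_mul x _ := by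
    refine Finsupp.lhom_ext' fun l => LinearMap.ext_ring ?_
    exact vertexOp_eq_self K (letterOp_single_mem K x l)
  mul_rng x _ := by
    refine Finsupp.lhom_ext' fun l => LinearMap.ext_ring ?_
    change D.letterOp e K x (D.vertexOp e K (D.rng x) (Finsupp.single l 1)) =
      D.letterOp e K x (Finsupp.single l 1)
    rw [vertexOp_single]
    split_ifs with h
    · rfl
    · rw [map_zero, letterOp_single, if_neg]
      exact fun h' => h ⟨h'.1, h'.2.2.symm⟩
  sum_mul t i j hi hj := by
    refine Finsupp.lhom_ext' fun l => LinearMap.ext_ring ?_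
    have := sum_letterOp_letterOp (e := e) K hi hj l
    simp only [LinearMap.comp_apply, Finsupp.lsingle_apply, LinearMap.sum_apply,
      Module.End.mul_apply, this]
    split_ifs <;> rfl

namespace CuntzFamily

variable {K} {A : Type} [Ring A] [Algebra K A] (F : CuntzFamily D A)

/-- The product of the letters of a word ending at `e`. -/
def word (e : V) (l : List (Letter T)) : A := (l.map F.ltr).prod * F.vtx e

theorem word_cons (x : Letter T) (l : List (Letter T)) :
    F.word e (x :: l) = F.ltr x * F.word e l := by
  simp [word, mul_assoc]

theorem start_mul_word {l : List (Letter T)} (h : D.Normal e l) :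
    F.vtx (D.start e l) * F.word e l = F.word e l := by
  cases l with
  | nil => simp [word, start, vtx_mul_vtx]
  | cons x l => rw [word_cons, ← mul_assoc, start, F.src_mul x h.1]

variable (K e) in
/-- The linear map sending a normal word to the corresponding product. -/
noncomputable def eval : (List (Letter T) →₀ K) →ₗ[K] A :=
  Finsupp.linearCombination K fun l => if D.Normal e l then F.word e l else 0

theorem eval_single (l : List (Letter T)) :
    F.eval e K (Finsupp.single l 1) = if D.Normal e l then F.word e l else 0 := by
  simp [eval]

theorem vtx_mul_word_of_ne {u : V} {l : List (Letter T)} (h : D.Normal e l)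
    (hu : D.start e l ≠ u) : F.vtx u * F.word e l = 0 := by
  rw [← F.start_mul_word h, ← mul_assoc, vtx_mul_vtx, if_neg hu.symm, zero_mul]

theorem eval_vertexOp (u : V) (m : List (Letter T) →₀ K) :
    F.eval e K (D.vertexOp e K u m) = F.vtx u * F.eval e K m := by
  suffices F.eval e K ∘ₗ D.vertexOp e K u = LinearMap.mulLeft K (F.vtx u) ∘ₗ F.eval e K from
    LinearMap.congr_fun this m
  refine Finsupp.lhom_ext' fun l => LinearMap.ext_ring ?_
  simp only [LinearMap.comp_apply, Finsupp.lsingle_apply, LinearMap.mulLeft_apply,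
    vertexOp_single, eval_single]
  by_cases hl : D.Normal e l
  · by_cases hu : D.start e l = u
    · subst hu
      simp [hl, eval_single, start_mul_word]
    · simp [hl, hu, vtx_mul_word_of_ne]
  · simp [hl]

theorem eval_letterOp {x : Letter T} (hx : D.Valid x) (m : List (Letter T) →₀ K) :
    F.eval e K (D.letterOp e K x m) = F.ltr x * F.eval e K m := by
  suffices F.eval e K ∘ₗ D.letterOp e K x = LinearMap.mulLeft K (F.ltr x) ∘ₗ F.eval e K from
    LinearMap.congr_fun this m
  refine Finsupp.lhom_ext' fun l => LinearMap.ext_ring ?_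
  simp only [LinearMap.comp_apply, Finsupp.lsingle_apply, LinearMap.mulLeft_apply, eval_single]
  by_cases hl : D.Normal e l
  swap
  · simp [letterOp_single, hl]
  rw [if_pos hl]
  by_cases hs : D.rng x = D.start e l
  swap
  · rw [letterOp_single, if_neg fun h => hs h.2.2, map_zero, ← F.mul_rng x hx, mul_assoc,
      F.vtx_mul_word_of_ne hl (Ne.symm hs), mul_zero]
  by_cases hf : ∀ y ∈ l.head?, ¬ D.Forb x y
  · have hN : D.Normal e (x :: l) := ⟨hx, hs, hf, hl⟩
    rw [letterOp_cons K hN, eval_single, if_pos hN, word_cons]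
  push Not at hf
  obtain ⟨y, hy, hf⟩ := hf
  cases l with
  | nil => simp at hy
  | cons y' l =>
  obtain rfl : y' = y := by simpa using hy
  obtain ⟨t, i, k⟩ := x
  obtain ⟨t', k', j⟩ := y'
  obtain ⟨rfl, rfl, rfl⟩ : t' = D.bar t ∧ k = 0 ∧ k' = 0 := hf
  have hj : j < D.sz t := by simpa using hl.1.2
  have h0 : 0 < D.sz (D.bar t) := hl.1.1
  rw [letterOp_forb K hx.1 hl, map_sub, map_sum, word_cons, ← mul_assoc]
  have := F.sum_mul t i j hx.1 hj
  rw [Finset.range_eq_Ico, Finset.sum_eq_sum_Ico_succ_bot h0] at this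
  rw [eq_sub_of_add_eq this, sub_mul, Finset.sum_mul]
  congr 1
  · have hst : D.vert t j = D.start e l := by
      rw [← hl.2.1]; simp [rng]
    split_ifs with hij
    · subst hij
      rw [eval_single, if_pos hl.tail, hst, F.start_mul_word hl.tail]
    · simp
  · refine Finset.sum_congr rfl fun m hm => ?_
    rw [Finset.mem_Ico] at hm
    rw [eval_single, if_pos (hl.cons_cons hx.1 hm.2 (by lia)), word_cons, word_cons, mul_assoc]

end CuntzFamily

variable {K}

variable (K T) in
/-- The span of the words of length at most `n`. -/
noncomputable def lengthSpan (n : ℕ) : Submodule K (List (Letter T) →₀ K) :=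
  Finsupp.supported K K {l | l.length ≤ n}

theorem single_mem_lengthSpan {n : ℕ} {l : List (Letter T)} (h : l.length ≤ n) :
    Finsupp.single l (1 : K) ∈ lengthSpan T K n :=
  Finsupp.single_mem_supported K _ h

theorem apply_eq_zero_of_mem_lengthSpan {n : ℕ} {m : List (Letter T) →₀ K}
    (h : m ∈ lengthSpan T K n) {l : List (Letter T)} (hl : n < l.length) : m l = 0 := by
  by_contra h0
  have := h (Finsupp.mem_support_iff.2 h0)
  exact absurd hl (not_lt.2 this)

theorem letterOp_mem_lengthSpan (x : Letter T) {n : ℕ} {m : List (Letter T) →₀ K}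
    (h : m ∈ lengthSpan T K n) : D.letterOp e K x m ∈ lengthSpan T K (n + 1) := by
  rw [lengthSpan, Finsupp.supported_eq_span_single] at h
  induction h using Submodule.span_induction with
  | mem y hy =>
    obtain ⟨l, hl, rfl⟩ := hy
    simp only [Set.mem_ofPred_eq] at hl
    simp only [letterOp_single]
    split_ifs
    · cases l with
      | nil => exact single_mem_lengthSpan (by simp)
      | cons y l =>
        simp only [List.length_cons] at hl
        rw [letterWord]
        split_ifs
        · exact sub_mem (single_mem_lengthSpan (by lia))
            (sum_mem fun k _ => single_mem_lengthSpan (by simp only [List.length_cons]; lia))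
        · exact sub_mem (zero_mem _)
            (sum_mem fun k _ => single_mem_lengthSpan (by simp only [List.length_cons]; lia))
        · exact single_mem_lengthSpan (by simp only [List.length_cons]; lia)
    · exact zero_mem _
  | zero => simp
  | add x y _ _ hx hy => rw [map_add]; exact add_mem hx hy
  | smul a x _ hx => rw [map_smul]; exact Submodule.smul_mem _ _ hx

variable (D e K) in
/-- Successive left multiplication by the letters of a word. -/
noncomputable def wordOp (p : List (Letter T)) : Module.End K (List (Letter T) →₀ K) :=
  (p.map (D.letterOp e K)).prod

theorem wordOp_cons (x : Letter T) (p : List (Letter T)) (m : List (Letter T) →₀ K) :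
    D.wordOp e K (x :: p) m = D.letterOp e K x (D.wordOp e K p m) := by
  simp [wordOp]

theorem wordOp_concat (x : Letter T) (p : List (Letter T)) (m : List (Letter T) →₀ K) :
    D.wordOp e K (p ++ [x]) m = D.wordOp e K p (D.letterOp e K x m) := by
  simp [wordOp]

theorem wordOp_mem_lengthSpan (p : List (Letter T)) {n : ℕ} {m : List (Letter T) →₀ K}
    (h : m ∈ lengthSpan T K n) : D.wordOp e K p m ∈ lengthSpan T K (p.length + n) := by
  induction p with
  | nil => simpa [wordOp] using h
  | cons x p ih =>
    rw [wordOp_cons, List.length_cons, add_right_comm]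
    exact letterOp_mem_lengthSpan x ih

theorem Normal.of_append {p q : List (Letter T)} (h : D.Normal e (p ++ q)) : D.Normal e q := by
  induction p with
  | nil => exact h
  | cons x p ih => exact ih h.tail

theorem wordOp_single {p q : List (Letter T)} (h : D.Normal e (p ++ q)) :
    D.wordOp e K p (Finsupp.single q 1) = Finsupp.single (p ++ q) 1 := by
  induction p with
  | nil => simp [wordOp]
  | cons x p ih => rw [wordOp_cons, ih h.tail]; exact letterOp_cons K h

theorem Normal.congr_getLast {v : V} {t : T} {i j k : ℕ} {p : List (Letter T)}
    {q : List (Letter T)} (hp : D.Normal v (p ++ [⟨t, i, j⟩]))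
    (hq : D.Normal e (⟨t, i, k⟩ :: q)) : D.Normal e (p ++ ⟨t, i, k⟩ :: q) := by
  induction p with
  | nil => exact hq
  | cons x p ih =>
    refine ⟨hp.1, ?_, ?_, ih hp.tail⟩
    · cases p with
      | nil => exact hp.2.1
      | cons => exact hp.2.1
    · cases p with
      | nil =>
        have := hp.2.2.1
        simpa [Forb] using this
      | cons => exact hp.2.2.1

/-- The coefficients of maximal length in the product of two normal words. -/
theorem wordOp_single_apply {v : V} {p₁ q₁ p q : List (Letter T)} {x y : Letter T}
    (hp₁ : D.Normal v p₁) (hq₁ : D.Normal e q₁) (hv : D.start e q₁ = v)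
    (hp : p₁.length ≤ p.length + 1) (hq : q₁.length ≤ q.length + 1)
    (hx : D.Valid x) (hf : ¬ D.Forb x y) :
    D.wordOp e K p₁ (Finsupp.single q₁ 1) (p ++ x :: y :: q) =
      (if p₁ = p ++ [x] then 1 else 0) * (if q₁ = y :: q then 1 else 0) -
        if y.edge = D.bar x.edge ∧ x.col = y.row then
          (if p₁ = p ++ [⟨x.edge, x.row, 0⟩] then 1 else 0) *
            (if q₁ = ⟨y.edge, 0, y.col⟩ :: q then 1 else 0) else 0 := by
  by_cases hlen : p₁.length = p.length + 1 ∧ q₁.length = q.length + 1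
  swap
  · rw [apply_eq_zero_of_mem_lengthSpan (wordOp_mem_lengthSpan p₁ (single_mem_lengthSpan le_rfl))
      (by simp only [List.length_append, List.length_cons]; lia)]
    have h : ∀ x' y' : Letter T, (if p₁ = p ++ [x'] then (1 : K) else 0) *
        (if q₁ = y' :: q then 1 else 0) = 0 := by
      intro x' y'
      split_ifs with h1 h2
      · exact absurd ⟨by simp [h1], by simp [h2]⟩ hlen
      all_goals simp
    simp [h]
  obtain ⟨hlp, hlq⟩ := hlen
  obtain rfl | ⟨p₁, x₁, rfl⟩ := p₁.eq_nil_or_concat'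
  · simp at hlp
  obtain _ | ⟨y₁, q₁⟩ := q₁
  · simp at hlq
  simp only [List.length_append, List.length_cons, List.length_nil, add_left_inj, zero_add]
    at hlp hlq
  by_cases hf₁ : D.Forb x₁ y₁
  · have hne : ¬ (p₁ ++ [x₁] = p ++ [x] ∧ y₁ :: q₁ = y :: q) := by
      rintro ⟨h1, h2⟩
      obtain rfl := (List.append_singleton_inj.1 h1).2
      obtain ⟨rfl, -⟩ := List.cons_eq_cons.1 h2
      exact hf hf₁
    have hx₁ : D.Valid x₁ := (Normal.of_append hp₁).1
    obtain ⟨t, i, c⟩ := x₁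
    obtain ⟨t', r, j⟩ := y₁
    obtain ⟨rfl, rfl, rfl⟩ : t' = D.bar t ∧ c = 0 ∧ r = 0 := hf₁
    have hdelta : D.wordOp e K p₁ (if i = j then Finsupp.single q₁ 1 else 0)
        (p ++ x :: y :: q) = 0 := by
      split_ifs
      · exact apply_eq_zero_of_mem_lengthSpan
          (wordOp_mem_lengthSpan p₁ (single_mem_lengthSpan le_rfl))
          (by simp only [List.length_append, List.length_cons]; lia)
      · simp
    have hsum : ∀ k ∈ Finset.Ico 1 (D.sz (D.bar t)),
        D.wordOp e K p₁ (Finsupp.single (⟨t, i, k⟩ :: ⟨D.bar t, k, j⟩ :: q₁) 1) =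
        Finsupp.single (p₁ ++ ⟨t, i, k⟩ :: ⟨D.bar t, k, j⟩ :: q₁) 1 := by
      intro k hk
      rw [Finset.mem_Ico] at hk
      exact wordOp_single (hp₁.congr_getLast (hq₁.cons_cons hx₁.1 hk.2 (by lia)))
    rw [wordOp_concat, letterOp_forb K hx₁.1 hq₁, map_sub, map_sum, Finset.sum_congr rfl hsum,
      Finsupp.sub_apply, hdelta, Finsupp.finsetSum_apply]
    have h1 : (if p₁ ++ [(⟨t, i, 0⟩ : Letter T)] = p ++ [x] then (1 : K) else 0) *
        (if (⟨D.bar t, 0, j⟩ : Letter T) :: q₁ = y :: q then 1 else 0) = 0 := by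
      split_ifs with h1 h2
      · exact absurd ⟨h1, h2⟩ hne
      all_goals simp
    rw [h1]
    congr 1
    simp only [Finsupp.single_apply]
    have happ : ∀ (a b : Letter T) (l : List (Letter T)),
        p₁ ++ a :: b :: l = p ++ x :: y :: q ↔ p₁ = p ∧ a = x ∧ b = y ∧ l = q := by
      intro a b l
      constructor
      · intro h
        have := List.append_inj h hlp
        simpa using this
      · rintro ⟨rfl, rfl, rfl, rfl⟩; rfl
    simp only [happ]
    obtain ⟨t', i', k⟩ := x
    obtain ⟨t'', k', j'⟩ := y
    by_cases hk : p₁ = p ∧ t = t' ∧ i = i' ∧ D.bar t = t'' ∧ k = k' ∧ j = j' ∧ q₁ = q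
    · obtain ⟨rfl, rfl, rfl, rfl, rfl, rfl, rfl⟩ := hk
      have hk0 : k ≠ 0 := fun h => hf ⟨rfl, h, h⟩
      have hkm : k ∈ Finset.Ico 1 (D.sz (D.bar t)) :=
        Finset.mem_Ico.2 ⟨by lia, hx.2⟩
      simp [hkm]
    · rw [Finset.sum_eq_zero fun m _ => if_neg ?_]
      · symm
        split_ifs with h1 h2 h3
        · exfalso
          simp only [List.append_singleton_inj, List.cons.injEq,
            Letter.mk.injEq] at h1 h2 h3
          grind
        all_goals simp
      · simp only [Letter.mk.injEq]
        grind
  · rw [wordOp_single (hq₁.append hv hp₁ (by simpa using hf₁)), Finsupp.single_apply]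
    have hiff : p₁ ++ [x₁] ++ y₁ :: q₁ = p ++ x :: y :: q ↔
        p₁ ++ [x₁] = p ++ [x] ∧ y₁ :: q₁ = y :: q := by
      constructor
      · intro h
        exact List.append_inj (by simpa using h) (by simp [hlp])
      · rintro ⟨h1, h2⟩
        rw [h1, h2]
        simp
    have hzero : ¬ ((y.edge = D.bar x.edge ∧ x.col = y.row) ∧
        p₁ ++ [x₁] = p ++ [⟨x.edge, x.row, 0⟩] ∧ y₁ :: q₁ = ⟨y.edge, 0, y.col⟩ :: q) := by
      rintro ⟨h, h1, h2⟩
      obtain rfl := (List.append_singleton_inj.1 h1).2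
      obtain ⟨rfl, -⟩ := List.cons_eq_cons.1 h2
      exact hf₁ ⟨h.1, rfl, rfl⟩
    simp only [hiff, ite_and]
    grind

variable (D e K) in
/-- The action of linear combinations of words on the space of normal words ending at `e`. -/
noncomputable def wordMul (a b : List (Letter T) →₀ K) : List (Letter T) →₀ K :=
  a.sum fun p c => c • D.wordOp e K p b

theorem wordMul_apply {u v : V} {a b : List (Letter T) →₀ K} (ha : a ∈ D.normalSpan K v u)
    (hb : b ∈ D.normalSpan K e v) {p q : List (Letter T)} {x y : Letter T}
    (hap : ∀ l ∈ a.support, l.length ≤ p.length + 1)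
    (hbq : ∀ l ∈ b.support, l.length ≤ q.length + 1) (hx : D.Valid x) (hf : ¬ D.Forb x y) :
    D.wordMul e K a b (p ++ x :: y :: q) = a (p ++ [x]) * b (y :: q) -
      if y.edge = D.bar x.edge ∧ x.col = y.row then
        a (p ++ [⟨x.edge, x.row, 0⟩]) * b (⟨y.edge, 0, y.col⟩ :: q) else 0 := by
  have hterm : ∀ p₁ ∈ a.support, a p₁ * D.wordOp e K p₁ b (p ++ x :: y :: q) =
      ∑ q₁ ∈ b.support, a p₁ * (b q₁ *
        ((if p₁ = p ++ [x] then 1 else 0) * (if q₁ = y :: q then 1 else 0) -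
        if y.edge = D.bar x.edge ∧ x.col = y.row then
          (if p₁ = p ++ [⟨x.edge, x.row, 0⟩] then 1 else 0) *
            (if q₁ = ⟨y.edge, 0, y.col⟩ :: q then 1 else 0) else 0)) := by
    intro p₁ h₁
    rw [← Finset.mul_sum]
    congr 1
    conv_lhs => rw [← b.sum_single, Finsupp.sum, map_sum, Finsupp.finsetSum_apply]
    refine Finset.sum_congr rfl fun q₁ h₂ => ?_
    rw [← wordOp_single_apply (ha h₁).1 (hb h₂).1 (hb h₂).2 (hap _ h₁) (hbq _ h₂) hx hf,
      ← smul_eq_mul, ← Finsupp.smul_apply, ← map_smul, Finsupp.smul_single, smul_eq_mul, mul_one]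
  have hpair : ∀ p₂ q₂ : List (Letter T), ∑ p₁ ∈ a.support, ∑ q₁ ∈ b.support, a p₁ * (b q₁ *
      ((if p₁ = p₂ then 1 else 0) * (if q₁ = q₂ then 1 else 0))) = a p₂ * b q₂ := by
    intro p₂ q₂
    simp only [mul_ite, mul_one, mul_zero, Finset.sum_ite_eq', Finsupp.mem_support_iff]
    by_cases h1 : a p₂ = 0 <;> by_cases h2 : b q₂ = 0 <;>
      simp [h1, h2, Finset.sum_ite_eq']
  rw [wordMul, Finsupp.sum, Finsupp.finsetSum_apply]
  simp only [Finsupp.smul_apply, smul_eq_mul]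
  rw [Finset.sum_congr rfl hterm]
  split_ifs
  · simp only [mul_sub, Finset.sum_sub_distrib, hpair]
  · simp only [sub_zero, hpair]

/-- The length of normal words is a local valuation: the maximal degrees of nonconstant
elements add up. -/
theorem exists_wordMul_apply_ne_zero {u v : V} {a b : List (Letter T) →₀ K}
    (ha : a ∈ D.normalSpan K v u) (hb : b ∈ D.normalSpan K e v) {p₀ q₀ : List (Letter T)}
    (hp₀ : a p₀ ≠ 0) (hq₀ : b q₀ ≠ 0) (hp : p₀ ≠ []) (hq : q₀ ≠ [])
    (hap : ∀ l ∈ a.support, l.length ≤ p₀.length)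
    (hbq : ∀ l ∈ b.support, l.length ≤ q₀.length) :
    ∃ l, l.length = p₀.length + q₀.length ∧ D.wordMul e K a b l ≠ 0 := by
  obtain rfl | ⟨p, x, rfl⟩ := p₀.eq_nil_or_concat'
  · exact absurd rfl hp
  obtain _ | ⟨y, q⟩ := q₀
  · exact absurd rfl hq
  by_contra! hzero
  simp only [List.length_append, List.length_cons, List.length_nil, zero_add] at hap hbq hzero
  have hvalid : ∀ x', a (p ++ [x']) ≠ 0 → D.Valid x' := fun x' h =>
    (Normal.of_append (ha (Finsupp.mem_support_iff.2 h)).1).1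
  have key : ∀ x' y', D.Valid x' → ¬ D.Forb x' y' → a (p ++ [x']) * b (y' :: q) =
      if y'.edge = D.bar x'.edge ∧ x'.col = y'.row then
        a (p ++ [⟨x'.edge, x'.row, 0⟩]) * b (⟨y'.edge, 0, y'.col⟩ :: q) else 0 := by
    intro x' y' hx hf
    rw [← sub_eq_zero, ← wordMul_apply ha hb hap hbq hx hf]
    exact hzero _ (by simp only [List.length_append, List.length_cons]; lia)
  have hlink : ∀ x' y', a (p ++ [x']) ≠ 0 → b (y' :: q) ≠ 0 →
      y'.edge = D.bar x'.edge ∧ x'.col = y'.row := by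
    intro x' y' hx hy
    by_contra h
    have := key x' y' (hvalid _ hx) fun hf => h ⟨hf.1, hf.2.1.trans hf.2.2.symm⟩
    rw [if_neg h] at this
    exact mul_ne_zero hx hy this
  have hxv := hvalid x hp₀
  obtain ⟨t, i, k⟩ := x
  obtain ⟨t', k', j⟩ := y
  obtain ⟨rfl, rfl⟩ : t' = D.bar t ∧ k = k' := hlink _ _ hp₀ hq₀
  have hab := mul_ne_zero hp₀ hq₀
  obtain rfl | hk := eq_or_ne k 0
  · have h2 := D.two_le_sz (D.bar t)
    have := key ⟨t, i, 1⟩ ⟨D.bar t, 1, j⟩ ⟨hxv.1, by simpa using (by lia : 1 < D.sz (D.bar t))⟩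
      (by simp [Forb])
    simp only [and_self, if_true] at this
    rw [← this] at hab
    have h3 := hlink _ _ (left_ne_zero_of_mul hab) hq₀
    simp at h3
  · have := key ⟨t, i, k⟩ ⟨D.bar t, k, j⟩ hxv (by simp [Forb, hk])
    simp only [and_self, if_true] at this
    rw [this] at hab
    have h3 := hlink _ _ (left_ne_zero_of_mul hab) hq₀
    simp [hk.symm] at h3

theorem exists_max_length {a : List (Letter T) →₀ K} (ha : a ≠ 0) :
    ∃ p, a p ≠ 0 ∧ ∀ l ∈ a.support, l.length ≤ p.length := by
  obtain ⟨p, hp, hmax⟩ := a.support.exists_max_image List.length (Finsupp.support_nonempty_iff.2 ha)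
  exact ⟨p, Finsupp.mem_support_iff.1 hp, hmax⟩

theorem eq_single_nil {a : List (Letter T) →₀ K} (h : ∀ l ∈ a.support, l.length ≤ 0) :
    a = Finsupp.single [] (a []) := by
  ext l
  rw [Finsupp.single_apply]
  split_ifs with hl
  · rw [hl]
  · by_contra h0
    exact hl (List.length_eq_zero_iff.1 (Nat.le_zero.1 (h l (Finsupp.mem_support_iff.2 h0)))).symm

theorem wordMul_single_nil (c : K) (b : List (Letter T) →₀ K) :
    D.wordMul e K (Finsupp.single [] c) b = c • b := by
  simp [wordMul, wordOp]

theorem wordMul_ne_zero {u v : V} {a b : List (Letter T) →₀ K}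
    (ha : a ∈ D.normalSpan K v u) (hb : b ∈ D.normalSpan K e v) (ha0 : a ≠ 0) (hb0 : b ≠ 0)
    (hbnil : b [] = 0) : D.wordMul e K a b ≠ 0 := by
  obtain ⟨p, hp, hpmax⟩ := exists_max_length ha0
  obtain ⟨q, hq, hqmax⟩ := exists_max_length hb0
  rcases eq_or_ne p [] with rfl | hpn
  · rw [eq_single_nil hpmax, wordMul_single_nil]
    exact smul_ne_zero hp hb0
  · obtain ⟨l, -, hl⟩ := exists_wordMul_apply_ne_zero ha hb hp hq hpn
      (by rintro rfl; exact hq hbnil) hpmax hqmax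
    exact fun h => hl (by simp [h])

/-- A nonconstant element has no left quasi-inverse. -/
theorem add_ne_wordMul {a b : List (Letter T) →₀ K} (ha : a ∈ D.normalSpan K e e)
    (hb : b ∈ D.normalSpan K e e) {q : List (Letter T)} (hq : b q ≠ 0) (hqn : q ≠ []) :
    b + a ≠ D.wordMul e K a b := by
  intro h
  have hb0 : b ≠ 0 := by rintro rfl; exact hq rfl
  rcases eq_or_ne a 0 with rfl | ha0
  · simp [wordMul, hb0] at h
  obtain ⟨p, hp, hpmax⟩ := exists_max_length ha0
  obtain ⟨q', hq', hqmax⟩ := exists_max_length hb0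
  have hqn' : q' ≠ [] := by
    rintro rfl
    have := hqmax q (Finsupp.mem_support_iff.2 hq)
    exact hqn (List.length_eq_zero_iff.1 (Nat.le_zero.1 this))
  rcases eq_or_ne p [] with rfl | hpn
  · rw [eq_single_nil hpmax, wordMul_single_nil] at h
    have h1 := DFunLike.congr_fun h q
    have h2 := DFunLike.congr_fun h []
    simp only [Finsupp.add_apply, Finsupp.smul_apply, smul_eq_mul,
      Finsupp.single_eq_of_ne hqn, Finsupp.single_eq_same, add_zero] at h1 h2
    have hc : a [] = 1 := mul_right_cancel₀ hq (by rw [one_mul]; exact h1.symm)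
    rw [hc, one_mul] at h2
    simp at h2
  · obtain ⟨l, hlen, hl⟩ := exists_wordMul_apply_ne_zero ha hb hp hq' hpn hqn' hpmax hqmax
    rw [← h, Finsupp.add_apply] at hl
    have hp' := List.length_pos_iff.2 hpn
    have hq'' := List.length_pos_iff.2 hqn'
    have h1 : b l = 0 := by
      by_contra h0
      have := hqmax l (Finsupp.mem_support_iff.2 h0)
      lia
    have h2 : a l = 0 := by
      by_contra h0
      have := hpmax l (Finsupp.mem_support_iff.2 h0)
      lia
    simp [h1, h2] at hl

end DoubledHypergraph

namespace HLPA

section Generators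

variable {H0 H1 : Type} {s r : H1 → List H0} (K : Type) [Field K]

variable (s r) in
/-- The element of the ambient algebra corresponding to a letter. -/
noncomputable def ambLetter : Letter (H1 × Bool) → Ambient K H0 H1 s r
  | ⟨(h, false), i, j⟩ =>
    if H : i < (s h).length ∧ j < (r h).length then
      amb K H0 H1 s r (.edge h ⟨i, H.1⟩ ⟨j, H.2⟩) else 0
  | ⟨(h, true), j, i⟩ =>
    if H : i < (s h).length ∧ j < (r h).length then
      amb K H0 H1 s r (.ghost h ⟨i, H.1⟩ ⟨j, H.2⟩) else 0

theorem ambLetter_false (h : H1) (i : Fin (s h).length) (j : Fin (r h).length) :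
    ambLetter s r K ⟨(h, false), i, j⟩ = amb K H0 H1 s r (.edge h i j) := by
  simp [ambLetter]

theorem ambLetter_true (h : H1) (i : Fin (s h).length) (j : Fin (r h).length) :
    ambLetter s r K ⟨(h, true), j, i⟩ = amb K H0 H1 s r (.ghost h i j) := by
  simp [ambLetter]

theorem amb_rel {x y : FreeAlgebra K (HGen H0 H1 s r)} (h : Rel K H0 H1 s r x y) :
    RingQuot.mkAlgHom K (Rel K H0 H1 s r) x = RingQuot.mkAlgHom K (Rel K H0 H1 s r) y :=
  RingQuot.mkAlgHom_rel K h

theorem amb_vertex_mul (u v : H0) :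
    amb K H0 H1 s r (.vertex u) * amb K H0 H1 s r (.vertex v) =
      if u = v then amb K H0 H1 s r (.vertex u) else 0 := by
  have := amb_rel K (.vtx (s := s) (r := r) u v)
  rw [map_mul] at this
  refine this.trans ?_
  split_ifs
  · rfl
  · simp

theorem letterSrc_mul_amb (g : HGen H0 H1 s r) :
    amb K H0 H1 s r (.vertex (letterSrc g)) * amb K H0 H1 s r g = amb K H0 H1 s r g := by
  cases g with
  | vertex v => simp [letterSrc, amb_vertex_mul]
  | edge h i j => exact (map_mul _ _ _).symm.trans (amb_rel K (.src_edge h i j))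
  | ghost h i j => exact (map_mul _ _ _).symm.trans (amb_rel K (.rng_ghost h i j))

theorem amb_mul_letterRng (g : HGen H0 H1 s r) :
    amb K H0 H1 s r g * amb K H0 H1 s r (.vertex (letterRng g)) = amb K H0 H1 s r g := by
  cases g with
  | vertex v => simp [letterRng, amb_vertex_mul]
  | edge h i j => exact (map_mul _ _ _).symm.trans (amb_rel K (.edge_rng h i j))
  | ghost h i j => exact (map_mul _ _ _).symm.trans (amb_rel K (.ghost_src h i j))

theorem ambient_induction {P : Ambient K H0 H1 s r → Prop}
    (halg : ∀ c, P (algebraMap K _ c)) (hgen : ∀ g, P (amb K H0 H1 s r g))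
    (hmul : ∀ a b, P a → P b → P (a * b)) (hadd : ∀ a b, P a → P b → P (a + b))
    (a : Ambient K H0 H1 s r) : P a := by
  obtain ⟨x, rfl⟩ := RingQuot.mkAlgHom_surjective K (Rel K H0 H1 s r) a
  induction x using FreeAlgebra.induction with
  | grade0 c => simpa using halg c
  | grade1 g => exact hgen g
  | mul x y hx hy => rw [map_mul]; exact hmul _ _ hx hy
  | add x y hx hy => rw [map_add]; exact hadd _ _ hx hy

end Generators

section Doubled

variable {H0 H1 : Type} [Nonempty H0] {s r : H1 → List H0}

/-- The doubled hypergraph of `(H0, H1, s, r)`: every hyperedge `h` is `(h, false)`, its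
opposite is `(h, true)`. -/
noncomputable def doubled (hLV : ∀ h : H1, 2 ≤ (s h).length ∧ 2 ≤ (r h).length) :
    DoubledHypergraph H0 (H1 × Bool) where
  sz t := (bif t.2 then r t.1 else s t.1).length
  vert t i := (bif t.2 then r t.1 else s t.1).getD i (Classical.arbitrary H0)
  bar t := (t.1, !t.2)
  bar_bar t := by simp
  two_le_sz t := by
    obtain ⟨h, _ | _⟩ := t
    · exact (hLV h).1
    · exact (hLV h).2

variable {hLV : ∀ h : H1, 2 ≤ (s h).length ∧ 2 ≤ (r h).length}

theorem doubled_vert_false (h : H1) (i : Fin (s h).length) :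
    (doubled hLV).vert (h, false) i = (s h).get i := by
  simp [doubled]

theorem doubled_vert_true (h : H1) (j : Fin (r h).length) :
    (doubled hLV).vert (h, true) j = (r h).get j := by
  simp [doubled]

theorem doubled_valid_edge (h : H1) (i : Fin (s h).length) (j : Fin (r h).length) :
    (doubled hLV).Valid ⟨(h, false), i, j⟩ := ⟨i.2, j.2⟩

theorem doubled_valid_ghost (h : H1) (i : Fin (s h).length) (j : Fin (r h).length) :
    (doubled hLV).Valid ⟨(h, true), j, i⟩ := ⟨j.2, i.2⟩

/-- The element of a family satisfying the relations that corresponds to a generator. -/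
def genVal {A : Type} [Ring A] (F : (doubled hLV).CuntzFamily A) : HGen H0 H1 s r → A
  | .vertex v => F.vtx v
  | .edge h i j => F.ltr ⟨(h, false), i, j⟩
  | .ghost h i j => F.ltr ⟨(h, true), j, i⟩

variable (K : Type) [Field K]

/-- The universal property of the ambient algebra. -/
noncomputable def lift {A : Type} [Ring A] [Algebra K A] (F : (doubled hLV).CuntzFamily A) :
    Ambient K H0 H1 s r →ₐ[K] A :=
  RingQuot.liftAlgHom K ⟨FreeAlgebra.lift K (genVal F), by
    intro x y hxy
    induction hxy with
    | vtx u v =>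
      have := F.vtx_mul_vtx u v
      split_ifs at this ⊢ <;> simpa [genVal] using this
    | src_edge h i j =>
      have := F.src_mul _ (doubled_valid_edge h i j)
      rw [DoubledHypergraph.src, doubled_vert_false] at this
      simp only [map_mul, FreeAlgebra.lift_ι_apply]
      exact this
    | edge_rng h i j =>
      have := F.mul_rng _ (doubled_valid_edge h i j)
      rw [DoubledHypergraph.rng] at this
      erw [doubled_vert_true] at this
      simp only [map_mul, FreeAlgebra.lift_ι_apply]
      exact this
    | rng_ghost h i j =>
      have := F.src_mul _ (doubled_valid_ghost h i j)
      rw [DoubledHypergraph.src, doubled_vert_true] at this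
      simp only [map_mul, FreeAlgebra.lift_ι_apply]
      exact this
    | ghost_src h i j =>
      have := F.mul_rng _ (doubled_valid_ghost h i j)
      rw [DoubledHypergraph.rng] at this
      erw [doubled_vert_false] at this
      simp only [map_mul, FreeAlgebra.lift_ι_apply]
      exact this
    | cuntz1 h i i' =>
      have := F.sum_mul (h, false) i i' i.2 i'.2
      rw [doubled_vert_false, Finset.sum_range] at this
      simp only [Fin.val_inj] at this
      rw [map_sum, apply_ite (FreeAlgebra.lift K (genVal F)), map_zero, FreeAlgebra.lift_ι_apply]
      simp only [map_mul, FreeAlgebra.lift_ι_apply]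
      exact this
    | cuntz2 h j j' =>
      have := F.sum_mul (h, true) j j' j.2 j'.2
      rw [doubled_vert_true, Finset.sum_range] at this
      simp only [Fin.val_inj] at this
      rw [map_sum, apply_ite (FreeAlgebra.lift K (genVal F)), map_zero, FreeAlgebra.lift_ι_apply]
      simp only [map_mul, FreeAlgebra.lift_ι_apply]
      exact this⟩

theorem lift_amb {A : Type} [Ring A] [Algebra K A] (F : (doubled hLV).CuntzFamily A)
    (g : HGen H0 H1 s r) : lift K F (amb K H0 H1 s r g) = genVal F g := by
  simp [lift, amb]

variable (hLV) in
/-- The generators of the ambient algebra satisfy the relations. -/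
noncomputable def ambFamily : (doubled hLV).CuntzFamily (Ambient K H0 H1 s r) where
  vtx v := amb K H0 H1 s r (.vertex v)
  ltr := ambLetter s r K
  vtx_mul_vtx := amb_vertex_mul K
  src_mul := by
    rintro ⟨⟨h, _ | _⟩, i, j⟩ ⟨hi, hj⟩
    · lift i to Fin (s h).length using hi
      lift j to Fin (r h).length using hj
      rw [ambLetter_false, DoubledHypergraph.src, doubled_vert_false]
      exact letterSrc_mul_amb K (.edge h i j)
    · lift i to Fin (r h).length using hi
      lift j to Fin (s h).length using hj
      rw [ambLetter_true, DoubledHypergraph.src, doubled_vert_true]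
      exact letterSrc_mul_amb K (.ghost h j i)
  mul_rng := by
    rintro ⟨⟨h, _ | _⟩, i, j⟩ ⟨hi, hj⟩
    · lift i to Fin (s h).length using hi
      lift j to Fin (r h).length using hj
      rw [ambLetter_false, DoubledHypergraph.rng]
      erw [doubled_vert_true]
      exact amb_mul_letterRng K (.edge h i j)
    · lift i to Fin (r h).length using hi
      lift j to Fin (s h).length using hj
      rw [ambLetter_true, DoubledHypergraph.rng]
      erw [doubled_vert_false]
      exact amb_mul_letterRng K (.ghost h j i)
  sum_mul := by
    rintro ⟨h, _ | _⟩ i j hi hj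
    · lift i to Fin (s h).length using hi
      lift j to Fin (s h).length using hj
      change ∑ k ∈ Finset.range (r h).length, ambLetter s r K ⟨(h, false), i, k⟩ *
        ambLetter s r K ⟨(h, true), k, j⟩ = _
      rw [Finset.sum_range, doubled_vert_false]
      simp only [ambLetter_false, ambLetter_true, Fin.val_inj]
      have := amb_rel K (.cuntz1 (s := s) (r := r) h i j)
      rw [map_sum, apply_ite (RingQuot.mkAlgHom K (Rel K H0 H1 s r)), map_zero] at this
      simp only [map_mul] at this
      exact this
    · lift i to Fin (r h).length using hi
      lift j to Fin (r h).length using hj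
      change ∑ k ∈ Finset.range (s h).length, ambLetter s r K ⟨(h, true), i, k⟩ *
        ambLetter s r K ⟨(h, false), k, j⟩ = _
      rw [Finset.sum_range, doubled_vert_true]
      simp only [ambLetter_false, ambLetter_true, Fin.val_inj]
      have := amb_rel K (.cuntz2 (s := s) (r := r) h i j)
      rw [map_sum, apply_ite (RingQuot.mkAlgHom K (Rel K H0 H1 s r)), map_zero] at this
      simp only [map_mul] at this
      exact this

open DoubledHypergraph in
variable (hLV) in
/-- The coordinates, with respect to the normal words ending at `e`, of `a` times the
vertex `e`. -/
noncomputable def coord (e : H0) (a : Ambient K H0 H1 s r) :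
    List (Letter (H1 × Bool)) →₀ K :=
  lift K (opFamily (doubled hLV) e K) a (Finsupp.single [] 1)

open DoubledHypergraph

theorem genVal_ambFamily (g : HGen H0 H1 s r) :
    genVal (ambFamily hLV K) g = amb K H0 H1 s r g := by
  cases g with
  | vertex v => rfl
  | edge h i j => exact ambLetter_false K h i j
  | ghost h i j => exact ambLetter_true K h i j

theorem eval_lift (e : H0) (a : Ambient K H0 H1 s r) :
    ∀ m, (ambFamily hLV K).eval e K (lift K (opFamily (doubled hLV) e K) a m) =
      a * (ambFamily hLV K).eval e K m := by
  induction a using ambient_induction with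
  | halg c => intro m; simp [Module.algebraMap_end_apply, Algebra.smul_def]
  | hgen g =>
    intro m
    rw [lift_amb, ← genVal_ambFamily (hLV := hLV)]
    cases g with
    | vertex v => exact (ambFamily hLV K).eval_vertexOp v m
    | edge h i j => exact (ambFamily hLV K).eval_letterOp (doubled_valid_edge h i j) m
    | ghost h i j => exact (ambFamily hLV K).eval_letterOp (doubled_valid_ghost h i j) m
  | hmul a b ha hb => intro m; rw [map_mul, Module.End.mul_apply, ha, hb, mul_assoc]
  | hadd a b ha hb => intro m; rw [map_add, LinearMap.add_apply, map_add, ha, hb, add_mul]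

theorem eval_coord (e : H0) (a : Ambient K H0 H1 s r) :
    (ambFamily hLV K).eval e K (coord hLV K e a) = a * amb K H0 H1 s r (.vertex e) := by
  rw [coord, eval_lift, CuntzFamily.eval_single, if_pos (show (doubled hLV).Normal e [] from trivial)]
  simp [CuntzFamily.word, ambFamily]

theorem lift_vertex (e u : H0) :
    lift K (opFamily (doubled hLV) e K) (amb K H0 H1 s r (.vertex u)) =
      (doubled hLV).vertexOp e K u :=
  lift_amb K _ _

theorem lift_ambLetter (e : H0) {x : Letter (H1 × Bool)} (hx : (doubled hLV).Valid x) :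
    lift K (opFamily (doubled hLV) e K) (ambLetter s r K x) = (doubled hLV).letterOp e K x := by
  obtain ⟨⟨h, _ | _⟩, i, j⟩ := x <;> obtain ⟨hi, hj⟩ := hx
  · lift i to Fin (s h).length using hi
    lift j to Fin (r h).length using hj
    rw [ambLetter_false, lift_amb]
    rfl
  · lift i to Fin (r h).length using hi
    lift j to Fin (s h).length using hj
    rw [ambLetter_true, lift_amb]
    rfl

theorem coord_mem_normalSpan (e : H0) {u : H0} {a : Ambient K H0 H1 s r}
    (ha : amb K H0 H1 s r (.vertex u) * a = a) :
    coord hLV K e a ∈ (doubled hLV).normalSpan K e u := by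
  rw [← ha, coord, map_mul, Module.End.mul_apply, lift_vertex]
  exact vertexOp_mem K u _

theorem coord_ne_zero {e : H0} {a : Ambient K H0 H1 s r}
    (ha : a * amb K H0 H1 s r (.vertex e) = a) (ha0 : a ≠ 0) : coord hLV K e a ≠ 0 := by
  intro h
  rw [← ha, ← eval_coord (hLV := hLV), h, map_zero] at ha0
  exact ha0 rfl

theorem lift_word (e v : H0) {p : List (Letter (H1 × Bool))} (hp : (doubled hLV).Normal v p) :
    lift K (opFamily (doubled hLV) e K) ((ambFamily hLV K).word v p) =
      (doubled hLV).wordOp e K p * (doubled hLV).vertexOp e K v := by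
  induction p with
  | nil =>
    rw [show (doubled hLV).wordOp e K [] = 1 from rfl, one_mul, CuntzFamily.word, List.map_nil,
      List.prod_nil, one_mul]
    exact lift_vertex K e v
  | cons x p ih =>
    rw [CuntzFamily.word_cons, map_mul, ih hp.tail]
    erw [lift_ambLetter K e hp.1]
    simp [wordOp, mul_assoc]

theorem coord_mul (e : H0) {u v : H0} {a b : Ambient K H0 H1 s r}
    (hua : amb K H0 H1 s r (.vertex u) * a = a) (hav : a * amb K H0 H1 s r (.vertex v) = a)
    (hvb : amb K H0 H1 s r (.vertex v) * b = b) :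
    coord hLV K e (a * b) = (doubled hLV).wordMul e K (coord hLV K v a) (coord hLV K e b) := by
  have hb := vertexOp_eq_self K (coord_mem_normalSpan (hLV := hLV) K e hvb)
  have ha := coord_mem_normalSpan (hLV := hLV) K v hua
  have key : coord hLV K e (a * b) = lift K (opFamily (doubled hLV) e K)
      ((ambFamily hLV K).eval v K (coord hLV K v a)) (coord hLV K e b) := by
    rw [eval_coord, hav, coord, map_mul, Module.End.mul_apply]
    rfl
  rw [key, CuntzFamily.eval, Finsupp.linearCombination_apply, wordMul, Finsupp.sum, Finsupp.sum,
    map_sum, LinearMap.sum_apply]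
  refine Finset.sum_congr rfl fun p hp => ?_
  rw [if_pos (ha hp).1, map_smul, LinearMap.smul_apply, lift_word K e v (ha hp).1,
    Module.End.mul_apply, hb]

theorem coord_ambLetter {x : Letter (H1 × Bool)} (hx : (doubled hLV).Valid x) :
    coord hLV K ((doubled hLV).rng x) (ambLetter s r K x) = Finsupp.single [x] 1 := by
  rw [coord, lift_ambLetter K _ hx]
  exact letterOp_cons K ⟨hx, rfl, by simp, trivial⟩

/-- Multiplication by a composable generator on the right is injective. -/
theorem mul_amb_ne_zero
    (hLV : ∀ h : H1, 2 ≤ (s h).length ∧ 2 ≤ (r h).length) {u : H0} (g : HGen H0 H1 s r)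
    {a : Ambient K H0 H1 s r}
    (hua : amb K H0 H1 s r (.vertex u) * a = a)
    (hag : a * amb K H0 H1 s r (.vertex (letterSrc g)) = a) (ha0 : a ≠ 0) :
    a * amb K H0 H1 s r g ≠ 0 := by
  have main : ∀ x : Letter (H1 × Bool), (doubled hLV).Valid x →
      ambLetter s r K x = amb K H0 H1 s r g → a * amb K H0 H1 s r g ≠ 0 := by
    intro x hx hxg h0
    have h := coord_mul (hLV := hLV) K ((doubled hLV).rng x) hua hag (letterSrc_mul_amb K g)
    have hmem := coord_mem_normalSpan (hLV := hLV) K ((doubled hLV).rng x) (letterSrc_mul_amb K g)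
    rw [h0] at h
    rw [← hxg, coord_ambLetter K hx] at h hmem
    refine wordMul_ne_zero (coord_mem_normalSpan K _ hua) hmem (coord_ne_zero K hag ha0)
      (by simp) (Finsupp.single_eq_of_ne (by simp)) (h.symm.trans ?_)
    simp [coord]
  cases g with
  | vertex v => exact fun h => ha0 (hag.symm.trans h)
  | edge h i j => exact main _ (doubled_valid_edge h i j) (ambLetter_false K h i j)
  | ghost h i j => exact main _ (doubled_valid_ghost h i j) (ambLetter_true K h i j)

end Doubled

section Semiprimitive

variable {K : Type} [Field K] {H0 H1 : Type} {s r : H1 → List H0}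

theorem amb_vertex_mul_amb {v : H0} (g : HGen H0 H1 s r) :
    amb K H0 H1 s r (.vertex v) * amb K H0 H1 s r g =
      if v = letterSrc g then amb K H0 H1 s r g else 0 := by
  rw [← letterSrc_mul_amb K g, ← mul_assoc, amb_vertex_mul]
  split_ifs with h
  · rw [h]
  · rw [zero_mul]

theorem amb_mul_amb_vertex {v : H0} (g : HGen H0 H1 s r) :
    amb K H0 H1 s r g * amb K H0 H1 s r (.vertex v) =
      if v = letterRng g then amb K H0 H1 s r g else 0 := by
  rw [← amb_mul_letterRng K g, mul_assoc, amb_vertex_mul]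
  by_cases h : v = letterRng g
  · simp [h]
  · simp [h, Ne.symm h]

/-- Finite sums of vertices are local units of the Leavitt path algebra. -/
theorem exists_local_unit {x : Ambient K H0 H1 s r} (hx : x ∈ LPAsub K H0 H1 s r) :
    ∃ F : Finset H0, ∀ G, F ⊆ G → (∑ v ∈ G, amb K H0 H1 s r (.vertex v)) * x = x ∧
      x * (∑ v ∈ G, amb K H0 H1 s r (.vertex v)) = x := by
  induction hx using NonUnitalAlgebra.adjoin_induction with
  | mem x hx =>
    obtain ⟨g, rfl⟩ := hx
    refine ⟨{letterSrc g, letterRng g}, fun G hG => ?_⟩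
    simp only [Finset.sum_mul, Finset.mul_sum, amb_vertex_mul_amb, amb_mul_amb_vertex,
      Finset.sum_ite_eq']
    simp [hG (Finset.mem_insert_self _ _),
      hG (Finset.mem_insert_of_mem (Finset.mem_singleton_self _))]
  | add x y _ _ hx hy =>
    obtain ⟨F, hF⟩ := hx
    obtain ⟨F', hF'⟩ := hy
    refine ⟨F ∪ F', fun G hG => ?_⟩
    have h1 := hF G (Finset.union_subset_left hG)
    have h2 := hF' G (Finset.union_subset_right hG)
    rw [mul_add, add_mul, h1.1, h1.2, h2.1, h2.2]
    exact ⟨rfl, rfl⟩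
  | zero => exact ⟨∅, by simp⟩
  | mul x y _ _ hx hy =>
    obtain ⟨F, hF⟩ := hx
    obtain ⟨F', hF'⟩ := hy
    refine ⟨F ∪ F', fun G hG => ?_⟩
    have h1 := hF G (Finset.union_subset_left hG)
    have h2 := hF' G (Finset.union_subset_right hG)
    rw [← mul_assoc, h1.1, mul_assoc, h2.2]
    exact ⟨rfl, rfl⟩
  | smul c x _ hx =>
    obtain ⟨F, hF⟩ := hx
    refine ⟨F, fun G hG => ?_⟩
    rw [mul_smul_comm, smul_mul_assoc, (hF G hG).1, (hF G hG).2]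
    exact ⟨rfl, rfl⟩

theorem exists_vertex_mul_mul_vertex_ne_zero {x : Ambient K H0 H1 s r}
    (hx : x ∈ LPAsub K H0 H1 s r) (hx0 : x ≠ 0) :
    ∃ u w, amb K H0 H1 s r (.vertex u) * x * amb K H0 H1 s r (.vertex w) ≠ 0 := by
  by_contra! h
  obtain ⟨F, hF⟩ := exists_local_unit hx
  obtain ⟨h1, h2⟩ := hF F subset_rfl
  apply hx0
  rw [← h2, ← h1, Finset.sum_mul, Finset.sum_mul]
  refine Finset.sum_eq_zero fun u _ => ?_
  rw [Finset.mul_sum]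
  exact Finset.sum_eq_zero fun w _ => h u w

/-- A predicate on vertices preserved by letters is preserved by d-paths. -/
theorem of_isDPath {Q : H0 → Prop} (hQ : ∀ g : HGen H0 H1 s r, Q (letterSrc g) → Q (letterRng g))
    {l : List (HGen H0 H1 s r)} (hl : IsDPath l) {x y : HGen H0 H1 s r}
    (hx : l.head? = some x) (hy : l.getLast? = some y) (h : Q (letterSrc x)) :
    Q (letterRng y) := by
  have hchain : l.IsChain fun x y => letterRng x = letterSrc y := by
    obtain ⟨v, rfl⟩ | ⟨-, -, hl⟩ := hl
    · simp
    · exact hl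
  clear hl
  induction l generalizing x with
  | nil => simp at hx
  | cons a l ih =>
    obtain rfl : a = x := by simpa using hx
    cases l with
    | nil =>
      obtain rfl : a = y := by simpa using hy
      exact hQ a h
    | cons b l =>
      rw [List.isChain_cons_cons] at hchain
      exact ih rfl (by simpa using hy) (hchain.1 ▸ hQ a h) hchain.2

end Semiprimitive

end HLPA

open HLPA in
/-- **Corollary 7.15 (Corollary \ref{corlocval4}).** If the hypergraph `H` satisfies
Condition (LV) and is connected, then `L_K(H)` is semiprimitive. -/
theorem stmt_16 (K : Type) [Field K] (H0 H1 : Type) [Nonempty H0]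
    (s r : H1 → List H0) (hs : ∀ h, s h ≠ []) (hr : ∀ h, r h ≠ [])
    (hLV : ∀ h : H1, 2 ≤ (s h).length ∧ 2 ≤ (r h).length)
    (hconn : ∀ v w : H0, ∃ l : List (HGen H0 H1 s r), IsDPath l ∧
      (∃ x, l.head? = some x ∧ letterSrc x = v) ∧
      (∃ y, l.getLast? = some y ∧ letterRng y = w)) :
    Semiprimitive (LPA K H0 H1 s r) := by
  intro J ⟨hJ0, _, _, hJl, hJr⟩ hJq
  refine Set.eq_singleton_iff_unique_mem.2 ⟨hJ0, fun x hx => ?_⟩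
  by_contra hx0
  obtain ⟨u, w, huw⟩ := exists_vertex_mul_mul_vertex_ne_zero x.2
    fun h => hx0 (Subtype.ext h)
  have hvv : ∀ v : H0, amb K H0 H1 s r (.vertex v) * amb K H0 H1 s r (.vertex v) =
      amb K H0 H1 s r (.vertex v) := fun v => by rw [amb_vertex_mul, if_pos rfl]
  let Q : H0 → Prop := fun v => ∃ y ∈ J, (y : Ambient K H0 H1 s r) ≠ 0 ∧
    amb K H0 H1 s r (.vertex u) * y = y ∧ (y : Ambient K H0 H1 s r) * amb K H0 H1 s r (.vertex v) = y
  have hQw : Q w := by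
    refine ⟨vgen K u * x * vgen K w, hJr _ _ (hJl _ _ hx), huw, ?_, ?_⟩
    · change amb K H0 H1 s r (.vertex u) * (amb K H0 H1 s r (.vertex u) * x *
        amb K H0 H1 s r (.vertex w)) = amb K H0 H1 s r (.vertex u) * x *
        amb K H0 H1 s r (.vertex w)
      rw [← mul_assoc, ← mul_assoc, hvv]
    · change amb K H0 H1 s r (.vertex u) * x * amb K H0 H1 s r (.vertex w) *
        amb K H0 H1 s r (.vertex w) = amb K H0 H1 s r (.vertex u) * x *
        amb K H0 H1 s r (.vertex w)
      rw [mul_assoc, hvv]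
  have hQ : ∀ g : HGen H0 H1 s r, Q (letterSrc g) → Q (letterRng g) := by
    rintro g ⟨y, hy, hy0, huy, hyv⟩
    refine ⟨y * genL K g, hJr _ _ hy, mul_amb_ne_zero K hLV g huy hyv hy0, ?_, ?_⟩
    · change amb K H0 H1 s r (.vertex u) * (y * amb K H0 H1 s r g) = y * amb K H0 H1 s r g
      rw [← mul_assoc, huy]
    · change y * amb K H0 H1 s r g * amb K H0 H1 s r (.vertex (letterRng g)) =
        y * amb K H0 H1 s r g
      rw [mul_assoc, amb_mul_letterRng]
  obtain ⟨l, hl, ⟨a, ha, rfl⟩, ⟨b, hb, hbu⟩⟩ := hconn w u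
  obtain ⟨y, hy, hy0, huy, hyu⟩ : Q u := hbu ▸ of_isDPath hQ hl ha hb hQw
  have hquasi : ∀ y ∈ J, amb K H0 H1 s r (.vertex u) * (y : Ambient K H0 H1 s r) = y →
      (y : Ambient K H0 H1 s r) * amb K H0 H1 s r (.vertex u) = y →
      ∃ z : Ambient K H0 H1 s r, amb K H0 H1 s r (.vertex u) * z = z ∧
        z * amb K H0 H1 s r (.vertex u) = z ∧ (y : Ambient K H0 H1 s r) + z = z * y := by
    intro y hy huy hyu
    obtain ⟨z, hz⟩ := hJq y hy
    replace hz : (y : Ambient K H0 H1 s r) + z = z * y := congrArg Subtype.val hz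
    refine ⟨amb K H0 H1 s r (.vertex u) * z * amb K H0 H1 s r (.vertex u), ?_, ?_, ?_⟩
    · rw [← mul_assoc, ← mul_assoc, hvv]
    · rw [mul_assoc, hvv]
    · have hzy : amb K H0 H1 s r (.vertex u) * (z * y) =
          y + amb K H0 H1 s r (.vertex u) * z := by rw [← hz, mul_add, huy]
      rw [mul_assoc _ _ (y : Ambient K H0 H1 s r), huy, mul_assoc, mul_assoc, hzy]
      have := congrArg (· * amb K H0 H1 s r (.vertex u)) hzy
      simp only [mul_assoc, add_mul, hyu] at this
      rw [← this, hzy]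
  by_cases hc : ∃ q, q ≠ [] ∧ coord hLV K u (y : Ambient K H0 H1 s r) q ≠ 0
  · obtain ⟨q, hqn, hq⟩ := hc
    obtain ⟨z, huz, hzu, hz⟩ := hquasi y hy huy hyu
    refine DoubledHypergraph.add_ne_wordMul (coord_mem_normalSpan K u huz)
      (coord_mem_normalSpan (hLV := hLV) K u huy) hq hqn ?_
    rw [← coord_mul K u huz hzu huy, ← hz]
    simp [coord]
  · push Not at hc
    obtain ⟨c, hyc⟩ : ∃ c : K, (y : Ambient K H0 H1 s r) = c • amb K H0 H1 s r (.vertex u) := by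
      refine ⟨coord hLV K u y [], ?_⟩
      have hsingle : coord hLV K u (y : Ambient K H0 H1 s r) =
          Finsupp.single [] (coord hLV K u (y : Ambient K H0 H1 s r) []) := by
        ext q
        by_cases hq : q = []
        · simp [hq]
        · rw [hc q hq, Finsupp.single_eq_of_ne hq]
      have heval := eval_coord (hLV := hLV) K u (y : Ambient K H0 H1 s r)
      rw [hyu, hsingle, ← Finsupp.smul_single_one, map_smul,
        DoubledHypergraph.CuntzFamily.eval_single,
        if_pos (show (doubled hLV).Normal u [] from trivial)] at heval
      refine heval.symm.trans ?_
      simp [DoubledHypergraph.CuntzFamily.word, ambFamily]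
    have hc0 : c ≠ 0 := fun h => hy0 (by rw [hyc, h, zero_smul])
    have hvJ : vgen K u ∈ J := by
      have : (c⁻¹ • vgen K u) * y = vgen K u := by
        refine Subtype.ext ?_
        change c⁻¹ • amb K H0 H1 s r (.vertex u) * y = amb K H0 H1 s r (.vertex u)
        rw [smul_mul_assoc, huy, hyc, inv_smul_smul₀ hc0]
      exact this ▸ hJl _ _ hy
    obtain ⟨z, -, hzu, hz⟩ := hquasi _ hvJ (hvv u) (hvv u)
    have hz' : amb K H0 H1 s r (.vertex u) + z = z := hz.trans hzu
    exact hy0 (by rw [← huy, add_eq_right.1 hz', zero_mul])
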